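/- arXiv:2602.09745 — 3 statements merged into one kernel-verified Lean document; each statement's English description precedes it below -/
import Mathlib

section
/- Let A = Σ_{j=0}^{m−1} y_j A_j, where each A_j is a 2^s × 2^s complex matrix and y ∈ ℂ^m. Suppose for each j the unitary U_j is an (α_j, a, ε_j)-block-encoding of A_j with α_j > 0, and set α = max_j α_j. Let y'_j = y_j α_j / α, let β' = Σ_{j=0}^{m−1} |y_j| α_j / α, and suppose (P_L, P_R) is a (β', n, γ)-state-preparation-pair for y'. Let W = Σ_{j=0}^{m−1} |j⟩⟨j| ⊗ U_j + (I_(2^n) − Σ_{j=0}^{m−1} |j⟩⟨j|) ⊗ I_(2^a) ⊗ I_(2^s). Then W̃ = (P_L^† ⊗ I_(2^a) ⊗ I_(2^s)) W (P_R ⊗ I_(2^a) ⊗ I_(2^s)) is a (Σ_{j=0}^{m−1} |y_j| α_j, a+n, αγ + Σ_{j=0}^{m−1} |y_j| ε_j)-block-encoding of A. -/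
open Matrix

/-- Spectral (operator 2-) norm of a square complex matrix. -/
noncomputable def specNorm {n : Type*} [Fintype n] [DecidableEq n] (A : Matrix n n ℂ) : ℝ :=
  ‖Matrix.toEuclideanCLM (𝕜 := ℂ) A‖

/-- Block encoding with ancilla register `ι` (index `0` is the all-zeros ancilla state). -/
def IsBlockEncoding {ι σ : Type*} [Fintype ι] [DecidableEq ι] [Zero ι]
    [Fintype σ] [DecidableEq σ]
    (α ε : ℝ) (U : Matrix (ι × σ) (ι × σ) ℂ) (A : Matrix σ σ ℂ) : Prop :=
  U ∈ Matrix.unitaryGroup (ι × σ) ℂ ∧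
    specNorm (A - α • Matrix.of (fun i j => U (0, i) (0, j))) ≤ ε

/-- Block encoding whose ancilla register is split as `ι × κ`, ordered (ι, κ, system). -/
def IsBlockEncoding₂ {ι κ σ : Type*} [Fintype ι] [DecidableEq ι] [Zero ι]
    [Fintype κ] [DecidableEq κ] [Zero κ] [Fintype σ] [DecidableEq σ]
    (α ε : ℝ) (U : Matrix (ι × κ × σ) (ι × κ × σ) ℂ) (A : Matrix σ σ ℂ) : Prop :=
  U ∈ Matrix.unitaryGroup (ι × κ × σ) ℂ ∧
    specNorm (A - α • Matrix.of (fun i j => U (0, 0, i) (0, 0, j))) ≤ ε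

/-- `(P_L, P_R)` is a `(β, n, γ)`-state-preparation-pair for `y ∈ ℂ^m`. -/
def IsStatePrepPair {m n : ℕ} (hm : m ≤ 2 ^ n) (y : Fin m → ℂ) (β γ : ℝ)
    (PL PR : Matrix (Fin (2 ^ n)) (Fin (2 ^ n)) ℂ) : Prop :=
  PL ∈ Matrix.unitaryGroup (Fin (2 ^ n)) ℂ ∧ PR ∈ Matrix.unitaryGroup (Fin (2 ^ n)) ℂ ∧
    (∑ j : Fin m,
        ‖(β : ℂ) * starRingEnd ℂ (PL (Fin.castLE hm j) 0) * PR (Fin.castLE hm j) 0 - y j‖) ≤ γ ∧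
    ∀ j : Fin (2 ^ n), m ≤ j.val → starRingEnd ℂ (PL j 0) * PR j 0 = 0

/-- The select unitary `W = ∑_{j<m} |j⟩⟨j| ⊗ U_j + (I - ∑_{j<m} |j⟩⟨j|) ⊗ I ⊗ I`. -/
def lcuSelect {m n a s : ℕ} (_hm : m ≤ 2 ^ n)
    (U : Fin m → Matrix (Fin (2 ^ a) × Fin (2 ^ s)) (Fin (2 ^ a) × Fin (2 ^ s)) ℂ) :
    Matrix (Fin (2 ^ n) × Fin (2 ^ a) × Fin (2 ^ s))
      (Fin (2 ^ n) × Fin (2 ^ a) × Fin (2 ^ s)) ℂ :=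
  Matrix.of fun p q =>
    if p.1 = q.1 then
      if h : p.1.val < m then U ⟨p.1.val, h⟩ p.2 q.2
      else if p.2 = q.2 then 1 else 0
    else 0

/-- Kronecker product `P ⊗ I` with the identity on the remaining registers. -/
def kronId {ι ρ : Type*} [DecidableEq ρ] (P : Matrix ι ι ℂ) : Matrix (ι × ρ) (ι × ρ) ℂ :=
  Matrix.of fun p q => P p.1 q.1 * (if p.2 = q.2 then (1 : ℂ) else 0)

open scoped Matrix.Norms.L2Operator in
theorem specNorm_eq_l2_opNorm {n : Type*} [Fintype n] [DecidableEq n] (A : Matrix n n ℂ) :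
    specNorm A = ‖A‖ :=
  Matrix.l2_opNorm_toEuclideanCLM A

theorem specNorm_add_le {n : Type*} [Fintype n] [DecidableEq n] (A B : Matrix n n ℂ) :
    specNorm (A + B) ≤ specNorm A + specNorm B := by
  simpa only [specNorm, map_add] using norm_add_le _ _

theorem specNorm_smul {n : Type*} [Fintype n] [DecidableEq n] (c : ℂ) (A : Matrix n n ℂ) :
    specNorm (c • A) = ‖c‖ * specNorm A := by
  simp only [specNorm, map_smul, norm_smul]

theorem specNorm_sum_le {n κ : Type*} [Fintype n] [DecidableEq n] (t : Finset κ)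
    (A : κ → Matrix n n ℂ) : specNorm (∑ j ∈ t, A j) ≤ ∑ j ∈ t, specNorm (A j) := by
  simpa only [specNorm, map_sum] using norm_sum_le _ _

open scoped Matrix.Norms.L2Operator in
theorem l2_opNorm_le_one_of_conjTranspose_mul_self_eq_one {n σ : Type*} [Fintype n]
    [DecidableEq n] [Fintype σ] [DecidableEq σ] {E : Matrix n σ ℂ} (hE : Eᴴ * E = 1) :
    ‖E‖ ≤ 1 := by
  have h := Matrix.l2_opNorm_conjTranspose_mul_self E
  have h1 := Matrix.l2_opNorm_conjTranspose_mul_self (1 : Matrix σ σ ℂ)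
  rw [hE] at h
  rw [Matrix.conjTranspose_one, Matrix.one_mul] at h1
  have hle : ‖(1 : Matrix σ σ ℂ)‖ ≤ 1 := by
    by_contra! hlt
    nlinarith
  nlinarith [norm_nonneg E]

open scoped Matrix.Norms.L2Operator in
/-- A square compression of a unitary matrix along an injective index map is a contraction. -/
theorem specNorm_submatrix_le_one {n σ : Type*} [Fintype n] [DecidableEq n] [Fintype σ]
    [DecidableEq σ] {U : Matrix n n ℂ} (hU : U ∈ Matrix.unitaryGroup n ℂ) {f : σ → n}
    (hf : Function.Injective f) : specNorm (U.submatrix f f) ≤ 1 := by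
  set E : Matrix n σ ℂ := (1 : Matrix n n ℂ).submatrix id f with hE
  have hEE : Eᴴ * E = 1 := by
    ext i j
    simp [hE, Matrix.mul_apply, Matrix.one_apply, hf.eq_iff]
  have hUU : Uᴴ * U = 1 := Matrix.mem_unitaryGroup_iff'.1 hU
  have hUE : (U * E)ᴴ * (U * E) = 1 := by
    rw [Matrix.conjTranspose_mul, Matrix.mul_assoc, ← Matrix.mul_assoc Uᴴ, hUU,
      Matrix.one_mul, hEE]
  have hsub : U.submatrix f f = Eᴴ * (U * E) := by
    ext i j
    simp [hE, Matrix.mul_apply, Matrix.one_apply]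
  rw [specNorm_eq_l2_opNorm, hsub]
  refine (Matrix.l2_opNorm_mul _ _).trans (mul_le_one₀ ?_ (norm_nonneg _)
    (l2_opNorm_le_one_of_conjTranspose_mul_self_eq_one hUE))
  rw [Matrix.l2_opNorm_conjTranspose]
  exact l2_opNorm_le_one_of_conjTranspose_mul_self_eq_one hEE

open scoped Kronecker in
theorem kronId_mem_unitaryGroup {ι ρ : Type*} [Fintype ι] [DecidableEq ι] [Fintype ρ]
    [DecidableEq ρ] {P : Matrix ι ι ℂ} (hP : P ∈ Matrix.unitaryGroup ι ℂ) :
    kronId (ρ := ρ) P ∈ Matrix.unitaryGroup (ι × ρ) ℂ := by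
  have h : kronId (ρ := ρ) P = P ⊗ₖ (1 : Matrix ρ ρ ℂ) := by
    ext p q
    simp [kronId, Matrix.kroneckerMap_apply, Matrix.one_apply]
  rw [h]
  exact Matrix.kronecker_mem_unitary hP (one_mem _)

theorem lcuSelect_mem_unitaryGroup {m n a s : ℕ} (hm : m ≤ 2 ^ n)
    {U : Fin m → Matrix (Fin (2 ^ a) × Fin (2 ^ s)) (Fin (2 ^ a) × Fin (2 ^ s)) ℂ}
    (hU : ∀ j, U j ∈ Matrix.unitaryGroup (Fin (2 ^ a) × Fin (2 ^ s)) ℂ) :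
    lcuSelect hm U ∈ Matrix.unitaryGroup (Fin (2 ^ n) × Fin (2 ^ a) × Fin (2 ^ s)) ℂ := by
  set V : Fin (2 ^ n) → Matrix (Fin (2 ^ a) × Fin (2 ^ s)) (Fin (2 ^ a) × Fin (2 ^ s)) ℂ :=
    fun k => if h : k.val < m then U ⟨k.val, h⟩ else 1 with hV
  have hVU : ∀ k, (V k)ᴴ * V k = 1 := by
    intro k
    by_cases h : k.val < m
    · simpa [hV, h, Matrix.star_eq_conjTranspose] using
        Matrix.mem_unitaryGroup_iff'.1 (hU ⟨k.val, h⟩)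
    · simp [hV, h]
  have hW : lcuSelect hm U =
      (Matrix.blockDiagonal V).submatrix (Equiv.prodComm _ _) (Equiv.prodComm _ _) := by
    ext ⟨k, x⟩ ⟨l, z⟩
    by_cases h : k.val < m <;>
      simp [lcuSelect, hV, Matrix.blockDiagonal_apply, h, Matrix.one_apply]
  rw [Matrix.mem_unitaryGroup_iff', Matrix.star_eq_conjTranspose, hW,
    Matrix.conjTranspose_submatrix, Matrix.submatrix_mul_equiv,
    Matrix.blockDiagonal_conjTranspose, ← Matrix.blockDiagonal_mul]
  rw [show (fun k => (V k)ᴴ * V k) = 1 from funext hVU, Matrix.blockDiagonal_one,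
    Matrix.submatrix_one_equiv]

theorem kronId_mul_apply {ι ρ : Type*} [Fintype ι] [Fintype ρ] [DecidableEq ρ]
    (P : Matrix ι ι ℂ) (M : Matrix (ι × ρ) (ι × ρ) ℂ) (i : ι) (x : ρ) (q : ι × ρ) :
    (kronId P * M : Matrix (ι × ρ) (ι × ρ) ℂ) (i, x) q = ∑ k, P i k * M (k, x) q := by
  simp [Matrix.mul_apply, kronId, Fintype.sum_prod_type]

theorem mul_kronId_apply {ι ρ : Type*} [Fintype ι] [Fintype ρ] [DecidableEq ρ]
    (P : Matrix ι ι ℂ) (M : Matrix (ι × ρ) (ι × ρ) ℂ) (p : ι × ρ) (j : ι) (z : ρ) :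
    (M * kronId P : Matrix (ι × ρ) (ι × ρ) ℂ) p (j, z) = ∑ k, M p (k, z) * P k j := by
  simp [Matrix.mul_apply, kronId, Fintype.sum_prod_type]

theorem lcuSelect_apply_castLE {m n a s : ℕ} (hm : m ≤ 2 ^ n)
    (U : Fin m → Matrix (Fin (2 ^ a) × Fin (2 ^ s)) (Fin (2 ^ a) × Fin (2 ^ s)) ℂ)
    (j : Fin m) (x z : Fin (2 ^ a) × Fin (2 ^ s)) :
    lcuSelect hm U (Fin.castLE hm j, x) (Fin.castLE hm j, z) = U j x z := by
  simp [lcuSelect]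

theorem lcuSelect_apply_of_ne {m n a s : ℕ} (hm : m ≤ 2 ^ n)
    (U : Fin m → Matrix (Fin (2 ^ a) × Fin (2 ^ s)) (Fin (2 ^ a) × Fin (2 ^ s)) ℂ)
    {k l : Fin (2 ^ n)} (h : k ≠ l) (x z : Fin (2 ^ a) × Fin (2 ^ s)) :
    lcuSelect hm U (k, x) (l, z) = 0 := by
  simp [lcuSelect, h]

/-- The all-zeros block of the LCU circuit is the combination of the `U_j` with weights
`c_j* d_j`. -/
theorem lcu_apply_zero {m n a s : ℕ} (hm : m ≤ 2 ^ n)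
    (U : Fin m → Matrix (Fin (2 ^ a) × Fin (2 ^ s)) (Fin (2 ^ a) × Fin (2 ^ s)) ℂ)
    {PL PR : Matrix (Fin (2 ^ n)) (Fin (2 ^ n)) ℂ}
    (h0 : ∀ j : Fin (2 ^ n), m ≤ j.val → starRingEnd ℂ (PL j 0) * PR j 0 = 0)
    (x z : Fin (2 ^ a) × Fin (2 ^ s)) :
    (kronId PLᴴ * lcuSelect hm U * kronId PR : Matrix (Fin (2 ^ n) × Fin (2 ^ a) × Fin (2 ^ s))
        (Fin (2 ^ n) × Fin (2 ^ a) × Fin (2 ^ s)) ℂ) (0, x) (0, z) =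
      ∑ j : Fin m,
        starRingEnd ℂ (PL (Fin.castLE hm j) 0) * PR (Fin.castLE hm j) 0 * U j x z := by
  have hdiag : (kronId PLᴴ * lcuSelect hm U * kronId PR : Matrix (Fin (2 ^ n) × Fin (2 ^ a) × Fin (2 ^ s))
        (Fin (2 ^ n) × Fin (2 ^ a) × Fin (2 ^ s)) ℂ) (0, x) (0, z) =
      ∑ k, starRingEnd ℂ (PL k 0) * PR k 0 * lcuSelect hm U (k, x) (k, z) := by
    rw [mul_kronId_apply]
    refine Finset.sum_congr rfl fun k _ => ?_
    rw [kronId_mul_apply, Finset.sum_eq_single k]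
    · rw [Matrix.conjTranspose_apply, starRingEnd_apply]
      ring
    · intro l _ hl
      rw [lcuSelect_apply_of_ne hm U hl, mul_zero]
    · simp
  rw [hdiag]
  symm
  refine Fintype.sum_of_injective (Fin.castLE hm) (Fin.castLE_injective hm) _ _ ?_ ?_
  · intro k hk
    have hmk : m ≤ k.val := by
      by_contra! hlt
      exact hk ⟨⟨k.val, hlt⟩, rfl⟩
    rw [h0 k hmk, zero_mul]
  · intro j
    rw [lcuSelect_apply_castLE]

/-- **LCU with non-uniform subnormalization factors.**  If each `U_j` is an
`(α_j, a, ε_j)`-block-encoding of `A_j`, `α = max_j α_j`, and `(P_L, P_R)` is a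
`(β', n, γ)`-state-preparation-pair for the rescaled coefficients
`y'_j = y_j α_j / α` with `β' = ∑_j |y_j| α_j / α`, then
`W̃ = (P_L† ⊗ I) W (P_R ⊗ I)` is a
`(∑_j |y_j| α_j, a + n, αγ + ∑_j |y_j| ε_j)`-block-encoding of `A = ∑_j y_j A_j`. -/
theorem lcu_block_encoding_weighted (m n a s : ℕ) (hm : m ≤ 2 ^ n)
    (y : Fin m → ℂ) (αj εj : Fin m → ℝ) (hαj : ∀ j, 0 < αj j)
    (α γ : ℝ) (hα : IsGreatest (Set.range αj) α)
    (A : Fin m → Matrix (Fin (2 ^ s)) (Fin (2 ^ s)) ℂ)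
    (U : Fin m → Matrix (Fin (2 ^ a) × Fin (2 ^ s)) (Fin (2 ^ a) × Fin (2 ^ s)) ℂ)
    (hU : ∀ j, IsBlockEncoding (αj j) (εj j) (U j) (A j))
    (PL PR : Matrix (Fin (2 ^ n)) (Fin (2 ^ n)) ℂ)
    (hP : IsStatePrepPair hm (fun j => y j * ((αj j : ℂ) / (α : ℂ)))
      (∑ j : Fin m, ‖y j‖ * αj j / α) γ PL PR) :
    IsBlockEncoding₂ (∑ j : Fin m, ‖y j‖ * αj j) (α * γ + ∑ j : Fin m, ‖y j‖ * εj j)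
      (kronId PLᴴ * lcuSelect hm U * kronId PR)
      (∑ j : Fin m, y j • A j) := by
  obtain ⟨hPL, hPR, hγ, h0⟩ := hP
  have hαpos : 0 < α := by
    obtain ⟨j, hj⟩ := hα.1
    exact hj ▸ hαj j
  have hα0 : (α : ℂ) ≠ 0 := by exact_mod_cast hαpos.ne'
  refine ⟨mul_mem (mul_mem (kronId_mem_unitaryGroup (Unitary.star_mem hPL))
    (lcuSelect_mem_unitaryGroup hm fun j => (hU j).1)) (kronId_mem_unitaryGroup hPR), ?_⟩
  set V : Fin m → Matrix (Fin (2 ^ s)) (Fin (2 ^ s)) ℂ :=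
    fun j => (U j).submatrix (Prod.mk 0) (Prod.mk 0) with hV
  set c : Fin m → ℂ :=
    fun j => starRingEnd ℂ (PL (Fin.castLE hm j) 0) * PR (Fin.castLE hm j) 0 with hc
  set β : ℝ := ∑ j : Fin m, ‖y j‖ * αj j / α with hβ
  have hαβ : ∑ j : Fin m, ‖y j‖ * αj j = α * β := by
    rw [hβ, ← Finset.sum_div, mul_div_cancel₀ _ hαpos.ne']
  have hV1 : ∀ j, specNorm (V j) ≤ 1 := fun j =>
    specNorm_submatrix_le_one (hU j).1 (Prod.mk_right_injective 0)
  have hsplit : ∑ j, y j • A j - (∑ j : Fin m, ‖y j‖ * αj j) • Matrix.of (fun i k =>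
        (kronId PLᴴ * lcuSelect hm U * kronId PR : Matrix (Fin (2 ^ n) × Fin (2 ^ a) × Fin (2 ^ s))
        (Fin (2 ^ n) × Fin (2 ^ a) × Fin (2 ^ s)) ℂ) (0, 0, i) (0, 0, k)) =
      ∑ j, (y j • (A j - αj j • V j) +
        (-(α : ℂ) * (β * c j - y j * ((αj j : ℂ) / (α : ℂ)))) • V j) := by
    ext i k
    simp only [lcu_apply_zero hm U h0, hαβ, Matrix.sub_apply, Matrix.smul_apply,
      Matrix.sum_apply, Matrix.add_apply, Matrix.of_apply, Complex.real_smul, smul_eq_mul,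
      Finset.mul_sum, ← Finset.sum_sub_distrib]
    refine Finset.sum_congr rfl fun j _ => ?_
    simp only [hV, hc, Matrix.submatrix_apply]
    push_cast
    field_simp
    ring
  rw [hsplit]
  calc _ ≤ ∑ j, (‖y j‖ * εj j + α * ‖β * c j - y j * ((αj j : ℂ) / (α : ℂ))‖) := by
        refine (specNorm_sum_le _ _).trans (Finset.sum_le_sum fun j _ => ?_)
        refine (specNorm_add_le _ _).trans ?_
        rw [specNorm_smul, specNorm_smul, norm_mul, norm_neg, Complex.norm_real,
          Real.norm_of_nonneg hαpos.le]
        exact add_le_add (mul_le_mul_of_nonneg_left (hU j).2 (norm_nonneg _))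
          (mul_le_of_le_one_right (by positivity) (hV1 j))
    _ ≤ α * γ + ∑ j, ‖y j‖ * εj j := by
        rw [Finset.sum_add_distrib, ← Finset.mul_sum, add_comm]
        gcongr
        simpa only [hc, mul_assoc] using hγ
end

section
/- Let A ∈ ℂ^(N×N) be s_r-row-sparse and s_c-column-sparse with all entries bounded in magnitude by c, i.e., |a_ij| ≤ c for all i, j, and let α > 0. Then the Hermitian matrix A†A + αI is positive definite, its eigenvalues lie in the interval [α, c²·s_r·s_c + α], and its condition number satisfies κ(A†A + αI) ≤ (c²·s_r·s_c + α)/α. -/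
open Matrix ComplexOrder

open Finset in
/-- A finite family with at most `s` nonzero entries, all of norm at most `c`, has `ℓ¹` norm at
most `s * c`. -/
theorem sum_norm_le_of_card_support_le {ι E : Type*} [Fintype ι] [NormedAddCommGroup E]
    [DecidableEq E] {a : ι → E} {s : ℕ} {c : ℝ} (hc : 0 ≤ c)
    (hs : (univ.filter fun k => a k ≠ 0).card ≤ s) (ha : ∀ k, ‖a k‖ ≤ c) :
    ∑ k, ‖a k‖ ≤ s * c := by
  calc ∑ k, ‖a k‖ = ∑ k ∈ univ.filter (fun k => a k ≠ 0), ‖a k‖ := by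
        refine (sum_filter_of_ne fun k _ hk => ?_).symm
        exact norm_ne_zero_iff.mp hk
    _ ≤ (univ.filter fun k => a k ≠ 0).card • c := sum_le_card_nsmul _ _ _ fun k _ => ha k
    _ ≤ s * c := by
        rw [nsmul_eq_mul]
        gcongr

/-- If the absolute row sums of `A` are at most `R` and its absolute column sums at most `C`, then
the absolute row sums of `Aᴴ * A` are at most `C * R`. -/
theorem Matrix.sum_norm_conjTranspose_mul_self_le {m n 𝕜 : Type*} [Fintype m] [Fintype n]
    [RCLike 𝕜] {A : Matrix m n 𝕜} {R C : ℝ} (hR : 0 ≤ R) (hrow : ∀ i, ∑ j, ‖A i j‖ ≤ R)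
    (hcol : ∀ j, ∑ i, ‖A i j‖ ≤ C) (j : n) : ∑ k, ‖(Aᴴ * A) j k‖ ≤ C * R := by
  calc ∑ k, ‖(Aᴴ * A) j k‖ ≤ ∑ k, ∑ i, ‖A i j‖ * ‖A i k‖ := by
        refine Finset.sum_le_sum fun k _ => ?_
        rw [Matrix.mul_apply]
        refine (norm_sum_le _ _).trans_eq ?_
        simp
    _ = ∑ i, ‖A i j‖ * ∑ k, ‖A i k‖ := by
        rw [Finset.sum_comm]
        simp_rw [Finset.mul_sum]
    _ ≤ ∑ i, ‖A i j‖ * R := by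
        gcongr with i
        exact hrow i
    _ ≤ C * R := by
        rw [← Finset.sum_mul]
        gcongr
        exact hcol j

/-- An eigenvalue of a matrix is bounded in norm by any common bound of its absolute row sums. -/
theorem Matrix.norm_eigenvalue_le_of_sum_norm_le {n 𝕜 : Type*} [Fintype n] [RCLike 𝕜]
    {B : Matrix n n 𝕜} {R : ℝ} (hB : ∀ i, ∑ j, ‖B i j‖ ≤ R) {μ : 𝕜} {v : n → 𝕜} (hv : v ≠ 0)
    (h : B *ᵥ v = μ • v) : ‖μ‖ ≤ R := by
  obtain ⟨i, hi⟩ := Function.ne_iff.mp hv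
  obtain ⟨j, -, hj⟩ := Finset.exists_max_image Finset.univ (fun k => ‖v k‖) ⟨i, Finset.mem_univ i⟩
  have hpos : 0 < ‖v j‖ := (norm_pos_iff.mpr hi).trans_le (hj i (Finset.mem_univ i))
  refine le_of_mul_le_mul_right ?_ hpos
  calc ‖μ‖ * ‖v j‖ = ‖(B *ᵥ v) j‖ := by simp [h]
    _ ≤ ∑ k, ‖B j k‖ * ‖v k‖ := by
        refine (norm_sum_le _ _).trans_eq ?_
        simp
    _ ≤ ∑ k, ‖B j k‖ * ‖v j‖ := by
        gcongr with k
        exact hj k (Finset.mem_univ k)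
    _ ≤ R * ‖v j‖ := by
        rw [← Finset.sum_mul]
        gcongr
        exact hB j

/-- An eigenvalue of a positive semidefinite matrix is nonnegative. -/
theorem Matrix.PosSemidef.nonneg_of_mulVec_eq_smul {n 𝕜 : Type*} [Fintype n] [RCLike 𝕜]
    {B : Matrix n n 𝕜} (hB : B.PosSemidef) {μ : 𝕜} {v : n → 𝕜} (hv : v ≠ 0)
    (h : B *ᵥ v = μ • v) : 0 ≤ μ := by
  have hnonneg := hB.dotProduct_mulVec_nonneg v
  rw [h, dotProduct_smul, smul_eq_mul] at hnonneg
  have hpos : 0 < star v ⬝ᵥ v := dotProduct_star_self_pos_iff.mpr hv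
  simpa [hpos.ne'] using mul_nonneg hnonneg (RCLike.inv_pos_of_pos hpos).le

/-- **Tikhonov-regularized normal matrix of a sparse matrix.**
If `A` is `s_r`-row-sparse and `s_c`-column-sparse with entries bounded by `c` and
`α > 0`, then `A†A + αI` is positive definite, its eigenvalues lie in
`[α, c² s_r s_c + α]`, and its condition number (largest eigenvalue over smallest
eigenvalue) is at most `(c² s_r s_c + α)/α`. -/
theorem tikhonov_normal_matrix_condition (N sr sc : ℕ) (hN : 0 < N)
    (A : Matrix (Fin N) (Fin N) ℂ) (c α : ℝ) (hα : 0 < α)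
    (hrow : ∀ i, (Finset.univ.filter fun j => A i j ≠ 0).card ≤ sr)
    (hcol : ∀ j, (Finset.univ.filter fun i => A i j ≠ 0).card ≤ sc)
    (hentry : ∀ i j, ‖A i j‖ ≤ c) :
    (Aᴴ * A + (α : ℂ) • (1 : Matrix (Fin N) (Fin N) ℂ)).PosDef ∧
      ∀ hM : (Aᴴ * A + (α : ℂ) • (1 : Matrix (Fin N) (Fin N) ℂ)).IsHermitian,
        (∀ i, α ≤ hM.eigenvalues i ∧ hM.eigenvalues i ≤ c ^ 2 * ((sr : ℝ) * (sc : ℝ)) + α) ∧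
          (⨆ i, hM.eigenvalues i) / (⨅ i, hM.eigenvalues i)
            ≤ (c ^ 2 * ((sr : ℝ) * (sc : ℝ)) + α) / α := by
  have hpsd : (Aᴴ * A).PosSemidef := posSemidef_conjTranspose_mul_self A
  have hc : 0 ≤ c := (norm_nonneg _).trans (hentry ⟨0, hN⟩ ⟨0, hN⟩)
  have hsum : ∀ j, ∑ k, ‖(Aᴴ * A) j k‖ ≤ (sc * c) * (sr * c) :=
    sum_norm_conjTranspose_mul_self_le (by positivity)
      (fun i => sum_norm_le_of_card_support_le hc (hrow i) (hentry i))
      (fun j => sum_norm_le_of_card_support_le hc (hcol j) fun i => hentry i j)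
  refine ⟨PosDef.posSemidef_add hpsd (PosDef.one.smul (by exact_mod_cast hα)), fun hM => ?_⟩
  have hbound : ∀ i, α ≤ hM.eigenvalues i ∧
      hM.eigenvalues i ≤ c ^ 2 * ((sr : ℝ) * (sc : ℝ)) + α := by
    intro i
    have hv : (hM.eigenvectorBasis i).ofLp ≠ 0 := fun h0 =>
      hM.eigenvectorBasis.orthonormal.ne_zero i (by ext k; simp [h0])
    have hmul : (Aᴴ * A) *ᵥ (hM.eigenvectorBasis i).ofLp =
        ((hM.eigenvalues i - α : ℝ) : ℂ) • (hM.eigenvectorBasis i).ofLp := by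
      have h := hM.mulVec_eigenvectorBasis i
      rw [add_mulVec, smul_mulVec, one_mulVec, ← eq_sub_iff_add_eq] at h
      rw [h, Complex.ofReal_sub, sub_smul, Complex.coe_smul (hM.eigenvalues i)]
    have hlower : 0 ≤ hM.eigenvalues i - α := by
      exact_mod_cast hpsd.nonneg_of_mulVec_eq_smul hv hmul
    have hupper := norm_eigenvalue_le_of_sum_norm_le hsum hv hmul
    rw [Complex.norm_real, Real.norm_of_nonneg hlower] at hupper
    constructor <;> linarith
  have : Nonempty (Fin N) := ⟨⟨0, hN⟩⟩
  refine ⟨hbound, ?_⟩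
  gcongr
  · exact ciSup_le fun i => (hbound i).2
  · exact le_ciInf fun i => (hbound i).1
end

section
/- Let X and Y be complex Hilbert spaces and let A : X → Y be an injective compact bounded linear operator with dense range in Y. For α > 0 define the Tikhonov regularization operator R_α = (A*A + αI)⁻¹A*, which is well defined since A*A + αI is boundedly invertible. Let f ∈ A(X) and f^δ ∈ Y satisfy ‖f^δ − f‖ ≤ δ < ‖f^δ‖ for some δ > 0. Then there exists a unique α = α(δ) > 0 such that ‖A R_{α(δ)} f^δ − f^δ‖ = δ. Moreover, as δ → 0 (over any family of data f^δ satisfying the above constraints), R_{α(δ)} f^δ converges in X to the unique x ∈ X with Ax = f. -/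
open ContinuousLinearMap

/-- The Tikhonov regularization operator `R_α = (A*A + αI)⁻¹ A*` of a bounded operator
`A : X →L Y` between complex Hilbert spaces.  (`Ring.inverse` is the genuine inverse
whenever `A*A + αI` is boundedly invertible, which holds for every `α > 0`.) -/
noncomputable def tikhonovOp {X Y : Type*}
    [NormedAddCommGroup X] [InnerProductSpace ℂ X] [CompleteSpace X]
    [NormedAddCommGroup Y] [InnerProductSpace ℂ Y] [CompleteSpace Y]
    (A : X →L[ℂ] Y) (α : ℝ) : Y →L[ℂ] X :=
  (Ring.inverse ((adjoint A).comp A + (α : ℂ) • (1 : X →L[ℂ] X))).comp (adjoint A)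

section Tikhonov

open scoped InnerProductSpace

variable {X Y : Type*}
  [NormedAddCommGroup X] [InnerProductSpace ℂ X] [CompleteSpace X]
  [NormedAddCommGroup Y] [InnerProductSpace ℂ Y] [CompleteSpace Y]

theorem isUnit_adjoint_comp_self_add_smul_one (A : X →L[ℂ] Y) {α : ℝ} (hα : 0 < α) :
    IsUnit ((adjoint A).comp A + (α : ℂ) • (1 : X →L[ℂ] X)) := by
  refine isUnit_of_forall_le_norm_inner_map _ (c := ⟨α, hα.le⟩) hα fun x => ?_
  have h : ⟪((adjoint A).comp A + (α : ℂ) • (1 : X →L[ℂ] X)) x, x⟫_ℂ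
      = ((‖A x‖ ^ 2 + α * ‖x‖ ^ 2 : ℝ) : ℂ) := by
    simp [adjoint_inner_left, inner_self_eq_norm_sq_to_K]
  rw [h, Complex.norm_real, Real.norm_of_nonneg (by positivity)]
  change ‖x‖ ^ 2 * α ≤ _
  nlinarith [sq_nonneg ‖A x‖]

theorem tikhonovOp_normal_equation (A : X →L[ℂ] Y) {α : ℝ} (hα : 0 < α) (g : Y) :
    adjoint A (A (tikhonovOp A α g)) + (α : ℂ) • tikhonovOp A α g = adjoint A g :=
  congrArg (fun T : X →L[ℂ] X => T (adjoint A g))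
    (Ring.mul_inverse_cancel _ (isUnit_adjoint_comp_self_add_smul_one A hα))

/-- The Tikhonov functional exceeds its minimum, attained at `tikhonovOp A α g`, by an explicit
quadratic. -/
theorem tikhonov_functional_eq (A : X →L[ℂ] Y) {α : ℝ} (hα : 0 < α) (g : Y) (v : X) :
    ‖A v - g‖ ^ 2 + α * ‖v‖ ^ 2 =
      ‖A (tikhonovOp A α g) - g‖ ^ 2 + α * ‖tikhonovOp A α g‖ ^ 2 +
        ‖A (v - tikhonovOp A α g)‖ ^ 2 + α * ‖v - tikhonovOp A α g‖ ^ 2 := by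
  have hn := tikhonovOp_normal_equation A hα g
  set u := tikhonovOp A α g
  have h0 : adjoint A (A u - g) + (α : ℂ) • u = 0 := by
    rw [map_sub, ← hn]; abel
  have h1 : RCLike.re ⟪A (v - u), A u - g⟫_ℂ + α * RCLike.re ⟪v - u, u⟫_ℂ = 0 := by
    have h := congrArg (fun w => RCLike.re ⟪v - u, w⟫_ℂ) h0
    simpa only [inner_add_right, inner_smul_right, adjoint_inner_right, inner_zero_right,
      map_add, map_zero, RCLike.re_to_complex, Complex.re_ofReal_mul] using h
  have h2 : A v - g = A (v - u) + (A u - g) := by rw [map_sub]; abel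
  have h3 := norm_add_sq (𝕜 := ℂ) (v - u) u
  rw [sub_add_cancel] at h3
  rw [h2, norm_add_sq (𝕜 := ℂ), h3]
  linear_combination 2 * h1

theorem continuousOn_tikhonovOp (A : X →L[ℂ] Y) (g : Y) :
    ContinuousOn (fun α : ℝ => tikhonovOp A α g) (Set.Ioi 0) := by
  intro α hα
  refine ContinuousAt.continuousWithinAt ?_
  obtain ⟨w, hw⟩ := isUnit_adjoint_comp_self_add_smul_one A hα
  have h1 : ContinuousAt (fun β : ℝ => (adjoint A).comp A + (β : ℂ) • (1 : X →L[ℂ] X)) α :=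
    (continuous_const.add (Complex.continuous_ofReal.smul continuous_const)).continuousAt
  have h2 := NormedRing.inverse_continuousAt w
  rw [hw] at h2
  exact (ContinuousAt.comp (f := fun β : ℝ => (adjoint A).comp A + (β : ℂ) • (1 : X →L[ℂ] X))
    h2 h1).clm_apply continuousAt_const

theorem exists_tikhonov_residual_eq (A : X →L[ℂ] Y) (hdense : DenseRange A) (g : Y) {δ : ℝ}
    (hδ : 0 < δ) (hg : δ < ‖g‖) :
    ∃ α : ℝ, 0 < α ∧ ‖A (tikhonovOp A α g) - g‖ = δ := by
  obtain ⟨a, ha, hal⟩ : ∃ a : ℝ, 0 < a ∧ ‖A (tikhonovOp A a g) - g‖ ≤ δ := by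
    obtain ⟨v, hv⟩ := hdense.exists_dist_lt g hδ
    rw [dist_comm, dist_eq_norm] at hv
    have hd : 0 < δ ^ 2 - ‖A v - g‖ ^ 2 := by nlinarith [norm_nonneg (A v - g)]
    have ha : 0 < (δ ^ 2 - ‖A v - g‖ ^ 2) / (‖v‖ ^ 2 + 1) := by positivity
    refine ⟨_, ha, ?_⟩
    have hJ := tikhonov_functional_eq A ha g v
    have hm : (δ ^ 2 - ‖A v - g‖ ^ 2) / (‖v‖ ^ 2 + 1) * (‖v‖ ^ 2 + 1) = δ ^ 2 - ‖A v - g‖ ^ 2 :=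
      div_mul_cancel₀ _ (by positivity)
    generalize (δ ^ 2 - ‖A v - g‖ ^ 2) / (‖v‖ ^ 2 + 1) = a at *
    have h1 : 0 ≤ a * ‖tikhonovOp A a g‖ ^ 2 := by positivity
    have h2 : 0 ≤ a * ‖v - tikhonovOp A a g‖ ^ 2 := by positivity
    refine (sq_le_sq₀ (norm_nonneg _) hδ.le).1 ?_
    nlinarith [sq_nonneg ‖A (v - tikhonovOp A a g)‖]
  obtain ⟨b, hb, hbl⟩ : ∃ b : ℝ, 0 < b ∧ δ ≤ ‖A (tikhonovOp A b g) - g‖ := by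
    have hd : 0 < ‖g‖ - δ := sub_pos.2 hg
    have hb : 0 < (‖A‖ ^ 2 * ‖g‖ ^ 2 + 1) / (‖g‖ - δ) ^ 2 := by positivity
    refine ⟨_, hb, ?_⟩
    have hJ := tikhonov_functional_eq A hb g 0
    have hm : (‖A‖ ^ 2 * ‖g‖ ^ 2 + 1) / (‖g‖ - δ) ^ 2 * (‖g‖ - δ) ^ 2 = ‖A‖ ^ 2 * ‖g‖ ^ 2 + 1 :=
      div_mul_cancel₀ _ (by positivity)
    generalize (‖A‖ ^ 2 * ‖g‖ ^ 2 + 1) / (‖g‖ - δ) ^ 2 = b at *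
    simp only [map_zero, zero_sub, norm_neg, norm_zero, map_neg] at hJ
    set u := tikhonovOp A b g
    have h1 : b * ‖u‖ ^ 2 ≤ ‖g‖ ^ 2 := by
      have : 0 ≤ b * ‖u‖ ^ 2 := by positivity
      nlinarith [sq_nonneg ‖A u‖, sq_nonneg ‖A u - g‖]
    have h2 : ‖A u‖ ^ 2 ≤ ‖A‖ ^ 2 * ‖u‖ ^ 2 := by
      rw [← mul_pow]; gcongr; exact A.le_opNorm u
    have h3 : b * ‖A u‖ ^ 2 ≤ b * (‖g‖ - δ) ^ 2 := by
      have := mul_le_mul_of_nonneg_left h2 hb.le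
      have := mul_le_mul_of_nonneg_left h1 (sq_nonneg ‖A‖)
      nlinarith
    have h4 : ‖A u‖ ≤ ‖g‖ - δ :=
      (sq_le_sq₀ (norm_nonneg _) hd.le).1 (le_of_mul_le_mul_left h3 hb)
    have h5 := norm_sub_norm_le g (A u)
    rw [norm_sub_rev g] at h5
    linarith
  have hc : ContinuousOn (fun α : ℝ => ‖A (tikhonovOp A α g) - g‖) (Set.Ioi 0) :=
    ((A.continuous.comp_continuousOn (continuousOn_tikhonovOp A g)).sub continuousOn_const).norm
  exact isPreconnected_Ioi.intermediate_value ha hb hc ⟨hal, hbl⟩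

theorem tikhonov_parameter_unique (A : X →L[ℂ] Y) (g : Y) {α β : ℝ} (hα : 0 < α) (hβ : 0 < β)
    (h : ‖A (tikhonovOp A α g) - g‖ = ‖A (tikhonovOp A β g) - g‖)
    (hg : ‖A (tikhonovOp A α g) - g‖ < ‖g‖) : α = β := by
  have h1 := tikhonov_functional_eq A hα g (tikhonovOp A β g)
  have h2 := tikhonov_functional_eq A hβ g (tikhonovOp A α g)
  have n1 := tikhonovOp_normal_equation A hα g
  have n2 := tikhonovOp_normal_equation A hβ g
  rw [h] at h1 h2
  have hle1 : α * (‖tikhonovOp A α g‖ ^ 2 + ‖tikhonovOp A β g - tikhonovOp A α g‖ ^ 2) ≤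
      α * ‖tikhonovOp A β g‖ ^ 2 := by
    nlinarith [sq_nonneg ‖A (tikhonovOp A β g - tikhonovOp A α g)‖]
  have hle2 : β * (‖tikhonovOp A β g‖ ^ 2 + ‖tikhonovOp A α g - tikhonovOp A β g‖ ^ 2) ≤
      β * ‖tikhonovOp A α g‖ ^ 2 := by
    nlinarith [sq_nonneg ‖A (tikhonovOp A α g - tikhonovOp A β g)‖]
  have hl1 := le_of_mul_le_mul_left hle1 hα
  have hl2 := le_of_mul_le_mul_left hle2 hβ
  have hz : ‖tikhonovOp A β g - tikhonovOp A α g‖ = 0 := by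
    rw [norm_sub_rev (tikhonovOp A α g)] at hl2
    refine pow_eq_zero_iff two_ne_zero |>.1 (le_antisymm ?_ (sq_nonneg _))
    linarith
  rw [sub_eq_zero.1 (norm_eq_zero.1 hz), ← n1] at n2
  have hu : tikhonovOp A α g ≠ 0 := by
    intro h0
    simp [h0] at hg
  exact_mod_cast (smul_left_injective ℂ hu (add_left_cancel n2)).symm

theorem denseRange_adjoint_of_injective (A : X →L[ℂ] Y) (hinj : Function.Injective A) :
    DenseRange (adjoint A) := by
  have h : (adjoint A).range.topologicalClosure = ⊤ := by
    rw [← orthogonal_ker, LinearMap.ker_eq_bot.2 hinj, Submodule.bot_orthogonal_eq_top]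
  exact Submodule.dense_iff_topologicalClosure_eq_top.2 h

/-- For injective `A`, a family of norm at most `‖x‖` whose images tend to `A x` tends to `x`. -/
theorem tendsto_of_norm_le_of_tendsto_map {ι : Type*} {l : Filter ι} (A : X →L[ℂ] Y)
    (hinj : Function.Injective A) {x : X} {u : ι → X} (hu : ∀ᶠ i in l, ‖u i‖ ≤ ‖x‖)
    (hAu : Filter.Tendsto (fun i => A (u i)) l (nhds (A x))) :
    Filter.Tendsto u l (nhds x) := by
  rw [Metric.tendsto_nhds]
  intro ε hε
  have hη : 0 < ε ^ 2 / (8 * (‖x‖ + 1)) := by positivity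
  obtain ⟨y, hy⟩ := (denseRange_adjoint_of_injective A hinj).exists_dist_lt x hη
  rw [dist_eq_norm, lt_div_iff₀ (by positivity)] at hy
  have hη' : 0 < ε ^ 2 / (8 * (‖y‖ + 1)) := by positivity
  filter_upwards [hu, (Metric.tendsto_nhds.1 hAu) _ hη'] with i hi hAi
  rw [dist_comm, dist_eq_norm, lt_div_iff₀ (by positivity)] at hAi
  rw [dist_comm, dist_eq_norm]
  refine lt_of_pow_lt_pow_left₀ 2 hε.le ?_
  have h1 : RCLike.re ⟪x - u i, x⟫_ℂ
      = RCLike.re ⟪x - u i, x - adjoint A y⟫_ℂ + RCLike.re ⟪A x - A (u i), y⟫_ℂ := by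
    rw [← map_sub A, ← adjoint_inner_right, ← map_add, ← inner_add_right, sub_add_cancel]
  have h2 := re_inner_le_norm (𝕜 := ℂ) (x - u i) (x - adjoint A y)
  have h3 := re_inner_le_norm (𝕜 := ℂ) (A x - A (u i)) y
  have h4 := norm_sub_sq (𝕜 := ℂ) (x - u i) x
  have h5 : ‖x - u i - x‖ = ‖u i‖ := by rw [sub_sub_cancel_left, norm_neg]
  have h6 : ‖x - u i‖ ≤ 2 * ‖x‖ := (norm_sub_le _ _).trans (by linarith)
  have h7 : ‖u i‖ ^ 2 ≤ ‖x‖ ^ 2 := by gcongr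
  have h8 := mul_le_mul_of_nonneg_right h6 (norm_nonneg (x - adjoint A y))
  rw [h5] at h4
  nlinarith [norm_nonneg (x - adjoint A y), norm_nonneg (A x - A (u i))]

theorem norm_tikhonovOp_le_of_discrepancy (A : X →L[ℂ] Y) {α : ℝ} (hα : 0 < α) (x : X) (g : Y)
    (h : ‖A x - g‖ ≤ ‖A (tikhonovOp A α g) - g‖) : ‖tikhonovOp A α g‖ ≤ ‖x‖ := by
  have hJ := tikhonov_functional_eq A hα g x
  have h1 : ‖A x - g‖ ^ 2 ≤ ‖A (tikhonovOp A α g) - g‖ ^ 2 := by gcongr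
  have h2 : 0 ≤ α * ‖x - tikhonovOp A α g‖ ^ 2 := by positivity
  refine (sq_le_sq₀ (norm_nonneg _) (norm_nonneg x)).1 (le_of_mul_le_mul_left ?_ hα)
  nlinarith [sq_nonneg ‖A (x - tikhonovOp A α g)‖]

end Tikhonov

/-- **Tikhonov regularization with Morozov's discrepancy principle.**  Let
`A : X → Y` be an injective compact bounded linear operator with dense range between
complex Hilbert spaces, and let `f = A x`.  For data `f^δ` with
`‖f^δ - f‖ ≤ δ < ‖f^δ‖` there is a unique `α(δ) > 0` with
`‖A R_{α(δ)} f^δ - f^δ‖ = δ`; and along any family of data `f^δ` satisfying these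
constraints (with `α(δ)` chosen by the discrepancy principle),
`R_{α(δ)} f^δ → x` as `δ → 0⁺`. -/
theorem tikhonov_discrepancy_principle {X Y : Type*}
    [NormedAddCommGroup X] [InnerProductSpace ℂ X] [CompleteSpace X]
    [NormedAddCommGroup Y] [InnerProductSpace ℂ Y] [CompleteSpace Y]
    (A : X →L[ℂ] Y) (hinj : Function.Injective A) (hcomp : IsCompactOperator A)
    (hdense : DenseRange A) (x : X) (f : Y) (hf : A x = f) :
    (∀ δ : ℝ, 0 < δ → ∀ fδ : Y, ‖fδ - f‖ ≤ δ → δ < ‖fδ‖ →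
      ∃! α : ℝ, 0 < α ∧ ‖A (tikhonovOp A α fδ) - fδ‖ = δ) ∧
    (∀ (fd : ℝ → Y) (αf : ℝ → ℝ),
      (∀ δ : ℝ, 0 < δ → ‖fd δ - f‖ ≤ δ ∧ δ < ‖fd δ‖) →
      (∀ δ : ℝ, 0 < δ → 0 < αf δ ∧ ‖A (tikhonovOp A (αf δ) (fd δ)) - fd δ‖ = δ) →
      Filter.Tendsto (fun δ => tikhonovOp A (αf δ) (fd δ))
        (nhdsWithin 0 (Set.Ioi 0)) (nhds x)) := by
  subst hf
  refine ⟨fun δ hδ fδ _ hlt => ?_, fun fd αf hfd hαf => ?_⟩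
  · obtain ⟨α, hα, h⟩ := exists_tikhonov_residual_eq A hdense fδ hδ hlt
    refine ⟨α, ⟨hα, h⟩, fun β hβ => ?_⟩
    exact tikhonov_parameter_unique A fδ hβ.1 hα (hβ.2.trans h.symm) (hβ.2.trans_lt hlt)
  · refine tendsto_of_norm_le_of_tendsto_map A hinj ?_ ?_
    · filter_upwards [self_mem_nhdsWithin] with δ hδ
      refine norm_tikhonovOp_le_of_discrepancy A (hαf δ hδ).1 x _ ?_
      rw [(hαf δ hδ).2, norm_sub_rev]
      exact (hfd δ hδ).1
    · have h0 : Filter.Tendsto (fun δ : ℝ => δ + δ) (nhdsWithin 0 (Set.Ioi 0)) (nhds 0) :=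
        tendsto_nhdsWithin_of_tendsto_nhds
          ((continuous_id.add continuous_id).tendsto' 0 0 (add_zero 0))
      refine tendsto_iff_norm_sub_tendsto_zero.2 (squeeze_zero' ?_ ?_ h0)
      · exact Filter.Eventually.of_forall fun δ => norm_nonneg _
      · filter_upwards [self_mem_nhdsWithin] with δ hδ
        calc ‖A (tikhonovOp A (αf δ) (fd δ)) - A x‖
            ≤ ‖A (tikhonovOp A (αf δ) (fd δ)) - fd δ‖ + ‖fd δ - A x‖ :=
              norm_sub_le_norm_sub_add_norm_sub _ _ _
          _ ≤ δ + δ := add_le_add (hαf δ hδ).2.le (hfd δ hδ).1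
end
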